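/- arXiv:1905.05646 — 2 statements merged into one kernel-verified Lean document; each statement's English description precedes it below -/
import Mathlib

section
/- Suppose the limit c := lim_{n→∞} (f_0^ξ(n))^{1/n} exists and is finite (this holds by the Marcus–Tardos theorem). Then for every integer r ≥ 1, the limit lim_{n→∞} (f_r^ξ(n))^{1/n} exists and equals c. -/
open Filter Topology

/-- The number of occurrences of the permutation pattern `ξ ∈ S_k` in `π ∈ S_n`:
strictly increasing index tuples `j : Fin k → Fin n` along which `π` is
order-isomorphic to `ξ`. -/
noncomputable def occP (k n : ℕ) (ξ : Equiv.Perm (Fin k)) (π : Equiv.Perm (Fin n)) : ℕ :=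
  Nat.card {j : Fin k → Fin n // StrictMono j ∧
    ∀ p q : Fin k, (π (j p) < π (j q) ↔ ξ p < ξ q)}

/-- `fperm k ξ r n` = number of permutations in `S_n` containing `ξ` exactly `r` times. -/
noncomputable def fperm (k : ℕ) (ξ : Equiv.Perm (Fin k)) (r n : ℕ) : ℕ :=
  Nat.card {π : Equiv.Perm (Fin n) // occP k n ξ π = r}

section Growth

variable {c : ℝ}

lemma tendsto_rpow_inv_add {a : ℕ → ℕ}
    (ha : Tendsto (fun n : ℕ => (a n : ℝ) ^ ((n : ℝ)⁻¹)) atTop (𝓝 c)) (m : ℕ) :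
    Tendsto (fun n : ℕ => (a n : ℝ) ^ (((n + m : ℕ) : ℝ)⁻¹)) atTop (𝓝 c) := by
  have hratio : Tendsto (fun n : ℕ => (n : ℝ) / ((n : ℝ) + m)) atTop (𝓝 1) :=
    tendsto_natCast_div_add_atTop (m : ℝ)
  have h := ha.rpow hratio (Or.inr one_pos)
  rw [Real.rpow_one] at h
  refine h.congr' ?_
  filter_upwards [eventually_gt_atTop 0] with n hn
  rw [← Real.rpow_mul (Nat.cast_nonneg _)]
  have hn' : (n : ℝ) ≠ 0 := by positivity
  congr 1
  push_cast
  field_simp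

lemma tendsto_rpow_inv_of_le_of_le {a x b : ℕ → ℕ}
    (ha : Tendsto (fun n : ℕ => (a n : ℝ) ^ ((n : ℝ)⁻¹)) atTop (𝓝 c))
    (hb : Tendsto (fun n : ℕ => (b n : ℝ) ^ ((n : ℝ)⁻¹)) atTop (𝓝 c))
    (m : ℕ) (hax : ∀ n, a n ≤ x (n + m)) (hxb : ∀ n, x n ≤ b n) :
    Tendsto (fun n : ℕ => (x n : ℝ) ^ ((n : ℝ)⁻¹)) atTop (𝓝 c) := by
  rw [← tendsto_add_atTop_iff_nat m] at hb ⊢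
  refine tendsto_of_tendsto_of_tendsto_of_le_of_le (tendsto_rpow_inv_add ha m) hb ?_ ?_ <;>
    intro n <;> dsimp only <;> gcongr
  · exact hax n
  · exact hxb _

lemma tendsto_rpow_inv_sq_mul_pred {a : ℕ → ℕ}
    (ha : Tendsto (fun n : ℕ => (a n : ℝ) ^ ((n : ℝ)⁻¹)) atTop (𝓝 c)) :
    Tendsto (fun n : ℕ => ((n * n * a (n - 1) : ℕ) : ℝ) ^ ((n : ℝ)⁻¹)) atTop (𝓝 c) := by
  have hn : Tendsto (fun n : ℕ => (n : ℝ) ^ ((n : ℝ)⁻¹)) atTop (𝓝 1) := by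
    simpa [Function.comp_def] using tendsto_rpow_div.comp tendsto_natCast_atTop_atTop
  have hpred : Tendsto (fun n : ℕ => (a (n - 1) : ℝ) ^ ((n : ℝ)⁻¹)) atTop (𝓝 c) := by
    rw [← tendsto_add_atTop_iff_nat 1]
    simpa using tendsto_rpow_inv_add ha 1
  have h := (hn.mul hn).mul hpred
  rw [one_mul, one_mul] at h
  refine h.congr fun n => ?_
  push_cast
  rw [Real.mul_rpow (by positivity) (by positivity),
    Real.mul_rpow (by positivity) (by positivity)]

end Growth

section Deletion

/-- The number of permutations in `S_n` containing `ξ` at most `r` times. -/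
noncomputable def fpermLE (k : ℕ) (ξ : Equiv.Perm (Fin k)) (r n : ℕ) : ℕ :=
  Nat.card {π : Equiv.Perm (Fin n) // occP k n ξ π ≤ r}

variable {k n : ℕ}

lemma fperm_le_fpermLE (ξ : Equiv.Perm (Fin k)) {r s : ℕ} (hrs : r ≤ s) (n : ℕ) :
    fperm k ξ r n ≤ fpermLE k ξ s n :=
  Nat.card_le_card_of_injective (Subtype.map id fun _ h => h.trans_le hrs)
    (Subtype.map_injective _ Function.injective_id)

lemma exists_delete (π : Equiv.Perm (Fin (n + 1))) (i : Fin (n + 1)) :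
    ∃ σ : Equiv.Perm (Fin n), ∀ j, π (i.succAbove j) = (π i).succAbove (σ j) := by
  have hne (j : Fin n) : π (i.succAbove j) ≠ π i := fun h =>
    Fin.succAbove_ne i j (π.injective h)
  choose f hf using fun j => Fin.exists_succAbove_eq (hne j)
  have hinj : Function.Injective f := fun a b hab => by
    have : π (i.succAbove a) = π (i.succAbove b) := by rw [← hf, ← hf, hab]
    exact Fin.succAbove_right_injective (π.injective this)
  exact ⟨Equiv.ofBijective f (Finite.injective_iff_bijective.mp hinj), fun j => (hf j).symm⟩

lemma occP_le_of_delete (ξ : Equiv.Perm (Fin k)) {π : Equiv.Perm (Fin (n + 1))}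
    {i : Fin (n + 1)} {σ : Equiv.Perm (Fin n)}
    (hσ : ∀ j, π (i.succAbove j) = (π i).succAbove (σ j)) {r : ℕ}
    (hr : occP k (n + 1) ξ π ≤ r + 1)
    (hi : occP k (n + 1) ξ π = 0 ∨ ∃ j : Fin k → Fin (n + 1), (StrictMono j ∧
      ∀ p q : Fin k, (π (j p) < π (j q) ↔ ξ p < ξ q)) ∧ i ∈ Set.range j) :
    occP k n ξ σ ≤ r := by
  let F : {j : Fin k → Fin n // StrictMono j ∧ ∀ p q, (σ (j p) < σ (j q) ↔ ξ p < ξ q)} →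
      {j : Fin k → Fin (n + 1) // StrictMono j ∧ ∀ p q, (π (j p) < π (j q) ↔ ξ p < ξ q)} :=
    fun j => ⟨fun p => i.succAbove (j.1 p), (Fin.strictMono_succAbove i).comp j.2.1,
      fun p q => by
        rw [hσ, hσ, (Fin.strictMono_succAbove (π i)).lt_iff_lt]
        exact j.2.2 p q⟩
  have hF : Function.Injective F := fun a b hab => Subtype.ext <| funext fun p =>
    Fin.succAbove_right_injective (congrFun (congrArg Subtype.val hab) p)
  rcases hi with h0 | ⟨j, hj, p, hp⟩
  · exact (Nat.card_le_card_of_injective F hF).trans (h0.trans_le (Nat.zero_le r))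
  · have hlt : occP k n ξ σ < occP k (n + 1) ξ π := by
      unfold occP
      rw [Nat.card_eq_fintype_card, Nat.card_eq_fintype_card]
      refine Fintype.card_lt_of_injective_of_notMem F hF (b := ⟨j, hj⟩) ?_
      rintro ⟨j', hj'⟩
      exact Fin.succAbove_ne i (j'.1 p) ((congrFun (congrArg Subtype.val hj') p).trans hp)
    omega

lemma fpermLE_succ_succ_le (hk : 1 ≤ k) (ξ : Equiv.Perm (Fin k)) (r n : ℕ) :
    fpermLE k ξ (r + 1) (n + 1) ≤ (n + 1) * (n + 1) * fpermLE k ξ r n := by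
  have key (π : {π : Equiv.Perm (Fin (n + 1)) // occP k (n + 1) ξ π ≤ r + 1}) :
      ∃ (i : Fin (n + 1)) (σ : {σ : Equiv.Perm (Fin n) // occP k n ξ σ ≤ r}),
        ∀ j, π.1 (i.succAbove j) = (π.1 i).succAbove (σ.1 j) := by
    obtain ⟨i, hi⟩ : ∃ i, occP k (n + 1) ξ π.1 = 0 ∨ ∃ j : Fin k → Fin (n + 1), (StrictMono j ∧
        ∀ p q : Fin k, (π.1 (j p) < π.1 (j q) ↔ ξ p < ξ q)) ∧ i ∈ Set.range j := by
      by_cases h0 : occP k (n + 1) ξ π.1 = 0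
      · exact ⟨0, Or.inl h0⟩
      · obtain ⟨⟨j, hj⟩⟩ := (Nat.card_ne_zero.mp h0).1
        exact ⟨j ⟨0, hk⟩, Or.inr ⟨j, hj, Set.mem_range_self _⟩⟩
    obtain ⟨σ, hσ⟩ := exists_delete π.1 i
    exact ⟨i, ⟨σ, occP_le_of_delete ξ hσ π.2 hi⟩, hσ⟩
  choose i σ hσ using key
  have hinj : Function.Injective fun π => ((i π, π.1 (i π)), σ π) := by
    intro π ρ h
    simp only [Prod.mk.injEq] at h
    obtain ⟨⟨hi, hv⟩, hs⟩ := h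
    refine Subtype.ext (Equiv.ext fun x => ?_)
    rcases Fin.eq_self_or_eq_succAbove (i π) x with rfl | ⟨j, rfl⟩
    · rw [hv, hi]
    · rw [hσ, hv, hs, ← hσ, hi]
  simpa [fpermLE, Nat.card_prod] using Nat.card_le_card_of_injective _ hinj

end Deletion

section Sum

variable {k n : ℕ}

/-- The permutation acting as `π` on the first `n` positions and as `ξ` on the last `k`
positions, the values being placed by `e`. -/
def glue (e : Fin n ⊕ Fin k ≃ Fin (n + k)) (π : Equiv.Perm (Fin n)) (ξ : Equiv.Perm (Fin k)) :
    Equiv.Perm (Fin (n + k)) :=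
  finSumFinEquiv.symm.trans ((Equiv.sumCongr π ξ).trans e)

@[simp]
lemma glue_castAdd (e : Fin n ⊕ Fin k ≃ Fin (n + k)) (π : Equiv.Perm (Fin n))
    (ξ : Equiv.Perm (Fin k)) (a : Fin n) :
    glue e π ξ (Fin.castAdd k a) = e (Sum.inl (π a)) := by
  simp [glue]

@[simp]
lemma glue_natAdd (e : Fin n ⊕ Fin k ≃ Fin (n + k)) (π : Equiv.Perm (Fin n))
    (ξ : Equiv.Perm (Fin k)) (b : Fin k) :
    glue e π ξ (Fin.natAdd n b) = e (Sum.inr (ξ b)) := by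
  simp [glue]

lemma occP_glue (e : Fin n ⊕ Fin (k + 1) ≃ Fin (n + (k + 1))) (ξ : Equiv.Perm (Fin (k + 1)))
    (hl : StrictMono fun a => e (Sum.inl a)) (hr : StrictMono fun b => e (Sum.inr b))
    (h : ∀ a b, ¬(e (Sum.inl a) < e (Sum.inr b) ↔ ξ 0 < ξ (Fin.last k)))
    (π : Equiv.Perm (Fin n)) :
    occP (k + 1) (n + (k + 1)) ξ (glue e π ξ) = occP (k + 1) n ξ π + 1 := by
  let F : {j : Fin (k + 1) → Fin n // StrictMono j ∧
      ∀ p q, (π (j p) < π (j q) ↔ ξ p < ξ q)} ⊕ Unit →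
      {j : Fin (k + 1) → Fin (n + (k + 1)) // StrictMono j ∧
        ∀ p q, (glue e π ξ (j p) < glue e π ξ (j q) ↔ ξ p < ξ q)} :=
    Sum.elim
      (fun j => ⟨fun p => Fin.castAdd (k + 1) (j.1 p), (Fin.strictMono_castAdd _).comp j.2.1,
        fun p q => by
          rw [glue_castAdd, glue_castAdd]
          exact (hl.lt_iff_lt).trans (j.2.2 p q)⟩)
      (fun _ => ⟨Fin.natAdd n, Fin.strictMono_natAdd n, fun p q => by
        rw [glue_natAdd, glue_natAdd]
        exact hr.lt_iff_lt⟩)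
  have hF : Function.Bijective F := by
    constructor
    · rintro (a | a) (b | b) hab
      · refine congrArg Sum.inl (Subtype.ext <| funext fun p => ?_)
        exact Fin.castAdd_injective _ _ (congrFun (congrArg Subtype.val hab) p)
      · have := congrArg Fin.val (congrFun (congrArg Subtype.val hab) 0)
        simp only [F, Sum.elim_inl, Sum.elim_inr, Fin.val_castAdd, Fin.val_natAdd] at this
        have := (a.1 0).isLt
        omega
      · have := congrArg Fin.val (congrFun (congrArg Subtype.val hab) 0)
        simp only [F, Sum.elim_inl, Sum.elim_inr, Fin.val_castAdd, Fin.val_natAdd] at this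
        have := (b.1 0).isLt
        omega
      · rfl
    · rintro ⟨j, hj, hocc⟩
      by_cases hlast : (j (Fin.last k) : ℕ) < n
      · have hlt (p) : (j p : ℕ) < n :=
          lt_of_le_of_lt (Fin.le_def.mp (hj.monotone (Fin.le_last p))) hlast
        have hcast (p) : j p = Fin.castAdd (k + 1) ⟨j p, hlt p⟩ := rfl
        refine ⟨Sum.inl ⟨fun p => ⟨j p, hlt p⟩, fun p q hpq => hj hpq, fun p q => ?_⟩, rfl⟩
        rw [← hocc p q, hcast p, hcast q, glue_castAdd, glue_castAdd]
        exact hl.lt_iff_lt.symm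
      · obtain ⟨b, hb⟩ : ∃ b, j (Fin.last k) = Fin.natAdd n b :=
          ⟨Fin.subNat n (Fin.cast (Nat.add_comm _ _) (j (Fin.last k))) (not_lt.mp hlast), by
            simp⟩
        have hzero : n ≤ (j 0 : ℕ) := by
          by_contra! h0
          have hcast : j 0 = Fin.castAdd (k + 1) ⟨j 0, h0⟩ := rfl
          have := hocc 0 (Fin.last k)
          rw [hb, hcast, glue_castAdd, glue_natAdd] at this
          exact h _ _ this
        have hle (p) : n ≤ (j p : ℕ) := hzero.trans (Fin.le_def.mp (hj.monotone (Fin.zero_le p)))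
        let g : Fin (k + 1) → Fin (k + 1) := fun p => ⟨j p - n, by have := (j p).isLt; omega⟩
        have hg : StrictMono g := fun p q hpq => by
          have h1 := Fin.lt_def.mp (hj hpq)
          have h2 := hle p
          simp only [g, Fin.lt_def]
          omega
        have hid : g = id := funext fun p => le_antisymm hg.apply_le hg.le_apply
        refine ⟨Sum.inr (), Subtype.ext <| funext fun p => Fin.ext ?_⟩
        have h1 : (j p : ℕ) - n = p := congrArg Fin.val (congrFun hid p)
        have h2 := hle p
        simp only [F, Sum.elim_inr, Fin.val_natAdd]
        omega
  simpa [occP, Nat.card_sum] using (Nat.card_congr (Equiv.ofBijective F hF)).symm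

lemma glue_injective (e : Fin n ⊕ Fin k ≃ Fin (n + k)) (ξ : Equiv.Perm (Fin k)) :
    Function.Injective fun π => glue e π ξ := by
  intro π ρ h
  refine Equiv.ext fun a => ?_
  have := Equiv.congr_fun h (Fin.castAdd k a)
  simpa using this

lemma exists_value_placement (ξ : Equiv.Perm (Fin (k + 1))) (n : ℕ) :
    ∃ e : Fin n ⊕ Fin (k + 1) ≃ Fin (n + (k + 1)),
      (StrictMono fun a => e (Sum.inl a)) ∧ (StrictMono fun b => e (Sum.inr b)) ∧
      ∀ a b, ¬(e (Sum.inl a) < e (Sum.inr b) ↔ ξ 0 < ξ (Fin.last k)) := by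
  by_cases hξ : ξ 0 < ξ (Fin.last k)
  · refine ⟨(Equiv.sumComm _ _).trans (finSumFinEquiv.trans (finCongr (Nat.add_comm _ _))),
      fun a b hab => ?_, fun a b hab => ?_, fun a b => ?_⟩
    · simpa using hab
    · simpa using Fin.strictMono_castAdd n hab
    · simp only [hξ, iff_true, not_lt, Fin.le_def]
      simp
      omega
  · refine ⟨finSumFinEquiv, fun a b hab => ?_, fun a b hab => ?_, fun a b => ?_⟩
    · simpa using Fin.strictMono_castAdd (k + 1) hab
    · simpa using hab
    · simp only [hξ, iff_false, not_not, Fin.lt_def]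
      simp
      omega

lemma fperm_le_fperm_succ_add (hk : 1 ≤ k) (ξ : Equiv.Perm (Fin k)) (r n : ℕ) :
    fperm k ξ r n ≤ fperm k ξ (r + 1) (n + k) := by
  obtain ⟨k, rfl⟩ := Nat.exists_eq_add_of_le' hk
  obtain ⟨e, hl, hr, h⟩ := exists_value_placement ξ n
  exact Nat.card_le_card_of_injective
    (Subtype.map (fun π => glue e π ξ) fun π hπ => by
      rw [occP_glue e ξ hl hr h, hπ])
    (Subtype.map_injective _ (glue_injective e ξ))

end Sum

lemma tendsto_fpermLE {k : ℕ} (hk : 1 ≤ k) (ξ : Equiv.Perm (Fin k)) {c : ℝ}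
    (hc : Tendsto (fun n : ℕ => (fperm k ξ 0 n : ℝ) ^ ((n : ℝ)⁻¹)) atTop (𝓝 c)) (r : ℕ) :
    Tendsto (fun n : ℕ => (fpermLE k ξ r n : ℝ) ^ ((n : ℝ)⁻¹)) atTop (𝓝 c) := by
  induction r with
  | zero => simpa [fpermLE, fperm] using hc
  | succ r ih =>
    rw [← tendsto_add_atTop_iff_nat 1]
    refine tendsto_of_tendsto_of_tendsto_of_le_of_le
      ((tendsto_add_atTop_iff_nat 1).mpr hc)
      ((tendsto_add_atTop_iff_nat 1).mpr (tendsto_rpow_inv_sq_mul_pred ih)) ?_ ?_ <;>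
      intro n <;> dsimp only <;> gcongr
    · exact fperm_le_fpermLE ξ (Nat.zero_le _) _
    · exact fpermLE_succ_succ_le hk ξ r n

/-- Theorem B: if the Stanley–Wilf limit `c = lim_n (f_0^ξ(n))^{1/n}` exists (as it does
by the Marcus–Tardos theorem), then for every `r ≥ 1` the limit
`lim_n (f_r^ξ(n))^{1/n}` exists and equals `c`. -/
theorem stanley_wilf_limits_permutations (k : ℕ) (hk : 1 ≤ k)
    (ξ : Equiv.Perm (Fin k)) (c : ℝ)
    (hc : Tendsto (fun n : ℕ => (fperm k ξ 0 n : ℝ) ^ ((n : ℝ)⁻¹)) atTop (𝓝 c))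
    (r : ℕ) (hr : 1 ≤ r) :
    Tendsto (fun n : ℕ => (fperm k ξ r n : ℝ) ^ ((n : ℝ)⁻¹)) atTop (𝓝 c) := by
  clear hr
  induction r with
  | zero => exact hc
  | succ r ih =>
    exact tendsto_rpow_inv_of_le_of_le ih (tendsto_fpermLE hk ξ hc (r + 1)) k
      (fperm_le_fperm_succ_add hk ξ r) (fperm_le_fpermLE ξ le_rfl)
end

section
/- (i) If the pattern ξ ∈ S_k satisfies ξ^{-1}(k) < ξ^{-1}(1) (i.e., the letter k appears before the letter 1 in ξ), then for all m, n ≥ 1 and every x ∈ [0,1]: c_{n+m}^ξ(x) ≥ c_n^ξ(x)·c_m^ξ(x). (ii) For every pattern ξ ∈ S_k and every x ∈ [0,1], the sequence (c_n^ξ(x))^{1/n} converges in the extended reals [0,+∞], i.e., lim_{n→∞} (c_n^ξ(x))^{1/n} exists (possibly equal to +∞). -/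
open Filter Topology

/-- The weak-avoidance partition function for permutations:
`c_n^ξ(x) = Σ_{π ∈ S_n} (1-x)^{occ_ξ(π)}`. -/
noncomputable def cperm (k : ℕ) (ξ : Equiv.Perm (Fin k)) (n : ℕ) (x : ℝ) : ℝ :=
  ∑ π : Equiv.Perm (Fin n), (1 - x) ^ (occP k n ξ π)

/-- The direct sum `π ⊕ σ` of two permutations: `π` on the first `n` points, a shifted copy of `σ`
on the last `m`. -/
def directSum {n m : ℕ} (π : Equiv.Perm (Fin n)) (σ : Equiv.Perm (Fin m)) :
    Equiv.Perm (Fin (n + m)) :=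
  finSumFinEquiv.permCongr (Equiv.Perm.sumCongr π σ)

lemma directSum_castAdd {n m : ℕ} (π : Equiv.Perm (Fin n)) (σ : Equiv.Perm (Fin m)) (i : Fin n) :
    directSum π σ (Fin.castAdd m i) = Fin.castAdd m (π i) := by
  simp [directSum, Equiv.permCongr_apply]

lemma directSum_natAdd {n m : ℕ} (π : Equiv.Perm (Fin n)) (σ : Equiv.Perm (Fin m)) (i : Fin m) :
    directSum π σ (Fin.natAdd n i) = Fin.natAdd n (σ i) := by
  simp [directSum, Equiv.permCongr_apply]

lemma directSum_injective (n m : ℕ) :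
    Function.Injective
      (fun p : Equiv.Perm (Fin n) × Equiv.Perm (Fin m) => directSum p.1 p.2) :=
  finSumFinEquiv.permCongr.injective.comp Equiv.Perm.sumCongrHom_injective

lemma le_directSum_apply_iff {n m : ℕ} (π : Equiv.Perm (Fin n)) (σ : Equiv.Perm (Fin m))
    (i : Fin (n + m)) : n ≤ (directSum π σ i : ℕ) ↔ n ≤ (i : ℕ) := by
  induction i using Fin.addCases with
  | left i =>
    simp only [directSum_castAdd, Fin.val_castAdd]
    omega
  | right i => simp [directSum_natAdd]

/-- If the largest letter of `ξ` does not come after its smallest one, then an occurrence of `ξ` in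
a direct sum lies entirely in one of the two summands. -/
lemma occP_directSum_le {k n m : ℕ} (ξ : Equiv.Perm (Fin k)) (a b : Fin k)
    (hmin : ∀ p, ξ a ≤ ξ p) (hmax : ∀ p, ξ p ≤ ξ b) (hba : b ≤ a)
    (π : Equiv.Perm (Fin n)) (σ : Equiv.Perm (Fin m)) :
    occP k (n + m) ξ (directSum π σ) ≤ occP k n ξ π + occP k m ξ σ := by
  unfold occP
  rw [← Nat.card_sum]
  refine Nat.card_le_card_of_surjective (Sum.elim
    (fun j => ⟨fun p => Fin.castAdd m (j.1 p), j.2.1, fun p q => by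
      simpa only [directSum_castAdd, (Fin.strictMono_castAdd m).lt_iff_lt] using j.2.2 p q⟩)
    (fun j => ⟨fun p => Fin.natAdd n (j.1 p), fun p q h => by simpa using j.2.1 h, fun p q => by
      simpa [directSum_natAdd] using j.2.2 p q⟩)) ?_
  rintro ⟨j, hj, hocc⟩
  have hle : ∀ p q, ξ p ≤ ξ q → directSum π σ (j p) ≤ directSum π σ (j q) := fun p q h =>
    not_lt.1 fun h' => not_lt.2 h ((hocc q p).1 h')
  by_cases hr : ∃ p, n ≤ (j p : ℕ)
  · obtain ⟨p, hp⟩ := hr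
    have hb : n ≤ (j b : ℕ) := (le_directSum_apply_iff π σ _).1
      (((le_directSum_apply_iff π σ _).2 hp).trans (hle p b (hmax p)))
    have ha : n ≤ (j a : ℕ) := hb.trans (hj.monotone hba)
    have hall : ∀ q, ∃ i : Fin m, Fin.natAdd n i = j q := fun q => by
      have hq : n ≤ (j q : ℕ) := (le_directSum_apply_iff π σ _).1
        (((le_directSum_apply_iff π σ _).2 ha).trans (hle a q (hmin q)))
      exact ⟨⟨j q - n, by omega⟩, Fin.ext (by simp; omega)⟩
    choose i hi using hall
    obtain rfl : (fun q => Fin.natAdd n (i q)) = j := funext hi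
    exact ⟨Sum.inr ⟨i, fun p q h => by simpa using hj h, fun p q => by
      simpa [directSum_natAdd] using hocc p q⟩, rfl⟩
  · push Not at hr
    have hall : ∀ q, ∃ i : Fin n, Fin.castAdd m i = j q := fun q => ⟨⟨j q, hr q⟩, rfl⟩
    choose i hi using hall
    obtain rfl : (fun q => Fin.castAdd m (i q)) = j := funext hi
    exact ⟨Sum.inl ⟨i, hj, fun p q => by
      simpa only [directSum_castAdd, (Fin.strictMono_castAdd m).lt_iff_lt] using hocc p q⟩, rfl⟩

lemma cperm_mul_le_cperm_add {k : ℕ} (ξ : Equiv.Perm (Fin k)) (a b : Fin k)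
    (hmin : ∀ p, ξ a ≤ ξ p) (hmax : ∀ p, ξ p ≤ ξ b) (hba : b ≤ a) (n m : ℕ)
    {x : ℝ} (hx : x ∈ Set.Icc (0 : ℝ) 1) :
    cperm k ξ n x * cperm k ξ m x ≤ cperm k ξ (n + m) x := by
  have h0 : 0 ≤ 1 - x := sub_nonneg.2 hx.2
  unfold cperm
  rw [Fintype.sum_mul_sum, ← Fintype.sum_prod_type']
  calc _ ≤ ∑ p : Equiv.Perm (Fin n) × Equiv.Perm (Fin m),
        (1 - x) ^ occP k (n + m) ξ (directSum p.1 p.2) := by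
        refine Finset.sum_le_sum fun p _ => ?_
        rw [← pow_add]
        exact pow_le_pow_of_le_one h0 (by linarith [hx.1])
          (occP_directSum_le ξ a b hmin hmax hba p.1 p.2)
    _ = ∑ τ ∈ Finset.univ.image
          (fun p : Equiv.Perm (Fin n) × Equiv.Perm (Fin m) => directSum p.1 p.2),
        (1 - x) ^ occP k (n + m) ξ τ :=
        by
        rw [Finset.sum_image (directSum_injective n m).injOn]
    _ ≤ _ := Finset.sum_le_univ_sum_of_nonneg fun _ => pow_nonneg h0 _

/-- Complementing the values of the pattern does not change the partition function. -/
lemma cperm_trans_revPerm (k : ℕ) (ξ : Equiv.Perm (Fin k)) (n : ℕ) (x : ℝ) :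
    cperm k (ξ.trans Fin.revPerm) n x = cperm k ξ n x := by
  refine Fintype.sum_equiv (Equiv.mulLeft (Fin.revPerm : Equiv.Perm (Fin n))) _ _ fun π => ?_
  congr 1
  refine Nat.card_congr (Equiv.subtypeEquivRight fun j => and_congr_right fun _ => ?_)
  rw [forall_comm]
  simp [Fin.lt_rev_iff]

lemma cperm_one_pos {k : ℕ} (ξ : Equiv.Perm (Fin k)) {x : ℝ}
    (h : 2 ≤ k ∨ x < 1) : 0 < cperm k ξ 1 x := by
  refine Finset.sum_pos (fun π _ => ?_) Finset.univ_nonempty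
  rcases h with hk | h
  · have : occP k 1 ξ π = 0 := by
      have : IsEmpty {j : Fin k → Fin 1 // StrictMono j ∧
          ∀ p q : Fin k, (π (j p) < π (j q) ↔ ξ p < ξ q)} := ⟨fun j => by
        have := Fintype.card_le_of_injective _ j.2.1.injective
        simp at this
        omega⟩
      exact Nat.card_of_isEmpty
    simp [this]
  · exact pow_pos (sub_pos.2 h) _

lemma cperm_pattern_one_eq_zero (ξ : Equiv.Perm (Fin 1)) {n : ℕ} (hn : 1 ≤ n) :
    cperm 1 ξ n 1 = 0 := by
  refine Finset.sum_eq_zero fun π _ => ?_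
  have : Nonempty {j : Fin 1 → Fin n // StrictMono j ∧
      ∀ p q : Fin 1, (π (j p) < π (j q) ↔ ξ p < ξ q)} :=
    ⟨⟨fun _ => ⟨0, hn⟩, Subsingleton.strictMono _, fun p q => by
      simp [Subsingleton.elim p q]⟩⟩
  have : occP 1 n ξ π ≠ 0 := Nat.card_pos.ne'
  simp [this]

/-- Fekete's lemma for positive supermultiplicative sequences, without any boundedness
assumption. -/
lemma exists_tendsto_rpow_inv_of_supermultiplicative {u : ℕ → ℝ} (hpos : ∀ n, 0 < u n)
    (hmul : ∀ n m, u n * u m ≤ u (n + m)) :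
    ∃ L : ENNReal, Tendsto (fun n : ℕ => ENNReal.ofReal (u n) ^ ((n : ℝ)⁻¹)) atTop (𝓝 L) := by
  have hsub : Subadditive fun n => -Real.log (u n) := fun m n => by
    have := Real.log_le_log (mul_pos (hpos m) (hpos n)) (hmul m n)
    rw [Real.log_mul (hpos m).ne' (hpos n).ne'] at this
    linarith
  have hexp : ∀ n : ℕ, ENNReal.ofReal (u n) ^ ((n : ℝ)⁻¹) =
      ENNReal.ofReal (Real.exp (-(-Real.log (u n) / n))) := fun n => by
    rw [ENNReal.ofReal_rpow_of_pos (hpos n), Real.rpow_def_of_pos (hpos n)]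
    congr 2
    ring
  simp only [hexp]
  by_cases hbdd : BddBelow (Set.range fun n : ℕ => -Real.log (u n) / n)
  · exact ⟨_, ENNReal.tendsto_ofReal
      (Real.continuous_exp.continuousAt.tendsto.comp (hsub.tendsto_lim hbdd).neg)⟩
  · refine ⟨⊤, ENNReal.tendsto_ofReal_atTop.comp
      (Real.tendsto_exp_atTop.comp (tendsto_neg_atBot_atTop.comp (tendsto_atBot.2 fun C => ?_)))⟩
    obtain ⟨_, ⟨n, rfl⟩, hn⟩ := not_bddBelow_iff.1 hbdd (min C 0)
    have hn0 : n ≠ 0 := by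
      rintro rfl
      simp at hn
    exact (hsub.eventually_div_lt_of_div_lt hn0 (hn.trans_le (min_le_left _ _))).mono
      fun _ h => h.le

lemma exists_tendsto_cperm_rpow_inv {k : ℕ} (ξ : Equiv.Perm (Fin k)) (a b : Fin k)
    (hmin : ∀ p, ξ a ≤ ξ p) (hmax : ∀ p, ξ p ≤ ξ b) (hba : b ≤ a)
    {x : ℝ} (hx : x ∈ Set.Icc (0 : ℝ) 1) :
    ∃ L : ENNReal, Tendsto (fun n : ℕ => ENNReal.ofReal (cperm k ξ n x) ^ ((n : ℝ)⁻¹))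
      atTop (𝓝 L) := by
  have hmul := fun n m => cperm_mul_le_cperm_add ξ a b hmin hmax hba n m hx
  by_cases h : 2 ≤ k ∨ x < 1
  · refine exists_tendsto_rpow_inv_of_supermultiplicative (fun n => ?_) hmul
    induction n with
    | zero =>
      have : IsEmpty (Fin k → Fin 0) := ⟨fun j => (j a).elim0⟩
      simp [cperm, occP]
    | succ n ih => exact (mul_pos ih (cperm_one_pos ξ h)).trans_le (hmul n 1)
  · push Not at h
    obtain rfl : x = 1 := le_antisymm hx.2 h.2
    obtain rfl : k = 1 := by have := a.pos; omega
    refine ⟨0, tendsto_const_nhds.congr' ?_⟩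
    filter_upwards [eventually_ge_atTop 1] with n hn
    have : (0 : ℝ) < (n : ℝ)⁻¹ := by positivity
    simp [cperm_pattern_one_eq_zero ξ hn, ENNReal.zero_rpow_of_pos this]

/-- Proposition: (i) if the largest letter `k` of `ξ` appears before its smallest
letter `1`, then `c_{n+m}^ξ(x) ≥ c_n^ξ(x)·c_m^ξ(x)` for `m,n ≥ 1`, `x ∈ [0,1]`;
(ii) for every `x ∈ [0,1]` the limit of `(c_n^ξ(x))^{1/n}` exists in `[0,+∞]`. -/
theorem cperm_supermultiplicative_and_limit (k : ℕ) (hk : 1 ≤ k)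
    (ξ : Equiv.Perm (Fin k)) :
    ((ξ.symm ⟨k - 1, by omega⟩ < ξ.symm ⟨0, by omega⟩) →
      ∀ m n : ℕ, 1 ≤ m → 1 ≤ n → ∀ x ∈ Set.Icc (0 : ℝ) 1,
        cperm k ξ n x * cperm k ξ m x ≤ cperm k ξ (n + m) x) ∧
    (∀ x ∈ Set.Icc (0 : ℝ) 1, ∃ L : ENNReal,
      Tendsto (fun n : ℕ => (ENNReal.ofReal (cperm k ξ n x)) ^ ((n : ℝ)⁻¹))
        atTop (𝓝 L)) := by
  have hmin : ∀ p, ξ (ξ.symm ⟨0, by omega⟩) ≤ ξ p := fun p => by simp [Fin.le_def]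
  have hmax : ∀ p, ξ p ≤ ξ (ξ.symm ⟨k - 1, by omega⟩) := fun p => by
    simp only [Equiv.apply_symm_apply, Fin.le_def]
    omega
  refine ⟨fun h m n _ _ x hx => cperm_mul_le_cperm_add ξ _ _ hmin hmax h.le n m hx,
    fun x hx => ?_⟩
  rcases le_total (ξ.symm ⟨k - 1, by omega⟩) (ξ.symm ⟨0, by omega⟩) with h | h
  · exact exists_tendsto_cperm_rpow_inv ξ _ _ hmin hmax h hx
  · simp only [← cperm_trans_revPerm k ξ]
    exact exists_tendsto_cperm_rpow_inv _ _ _ (fun p => by simpa using hmax p)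
      (fun p => by simpa using hmin p) h hx
end
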